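/- arXiv:2602.20457 — 4 statements merged into one kernel-verified Lean document; each statement's English description precedes it below -/
import Mathlib

section
/- Let X and Y be finite nonempty types, μ : X → [0,1] with Σ_x μ(x) = 1, ψ : X × Y → ℝ^d, θ_ref ∈ ℝ^d, β > 0, δ ∈ (0,1/2], ρ ∈ (0,δ), and p⋆ : X × Y × Y → [δ, 1−δ]. For θ ∈ ℝ^d define the softmax policy π_θ(y|x) := exp(⟪θ, ψ(x,y)⟫)/Σ_{y'} exp(⟪θ, ψ(x,y')⟫), the sampling weight d_θ(x,y₁,y₂) := μ(x)·π_θ(y₁|x)·π_θ(y₂|x), the logit h_θ(x,y₁,y₂) := log(π_θ(y₁|x)/π_{θ_ref}(y₁|x)) − log(π_θ(y₂|x)/π_{θ_ref}(y₂|x)), and losses ℓ¹_θ(z) := −log σ(β·h_θ(z)), ℓ⁰_θ(z) := −log σ(−β·h_θ(z)), where σ(u) = 1/(1+e^{−u}). Define L_SAIL(θ) := Σ_z d_θ(z)·(p⋆(z)·ℓ¹_θ(z) + (1−p⋆(z))·ℓ⁰_θ(z)) and L^W_ρ(θ) := sup over p : X×Y×Y → [0,1] with |p(z)−p⋆(z)|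 ≤ ρ for all z of Σ_z d_θ(z)·(p(z)·ℓ¹_θ(z) + (1−p(z))·ℓ⁰_θ(z)). Then for all θ: L^W_ρ(θ) = L_SAIL(θ) + ρ·β·R(θ), where R(θ) := Σ_{x,y₁,y₂} d_θ(x,y₁,y₂)·|⟪θ − θ_ref, ψ(x,y₁) − ψ(x,y₂)⟫|. -/
open scoped RealInnerProductSpace BigOperators

/-- The log-linear (softmax) policy `π_θ(y|x) = exp⟪θ, ψ(x,y)⟫ / Σ_{y'} exp⟪θ, ψ(x,y')⟫`. -/
noncomputable def softmaxPolicy {n : ℕ} {X Y : Type*} [Fintype Y]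
    (ψ : X × Y → EuclideanSpace ℝ (Fin n)) (θ : EuclideanSpace ℝ (Fin n)) (x : X) (y : Y) : ℝ :=
  Real.exp ⟪θ, ψ (x, y)⟫ / ∑ y' : Y, Real.exp ⟪θ, ψ (x, y')⟫

/-- The logistic sigmoid `σ(u) = 1/(1 + e^{-u})`. -/
noncomputable def sigmoid (u : ℝ) : ℝ := 1 / (1 + Real.exp (-u))

/-- Policy-induced sampling weight `d_θ(x,y₁,y₂) = μ(x) π_θ(y₁|x) π_θ(y₂|x)`. -/
noncomputable def sampleWeight {n : ℕ} {X Y : Type*} [Fintype Y] (μ : X → ℝ)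
    (ψ : X × Y → EuclideanSpace ℝ (Fin n)) (θ : EuclideanSpace ℝ (Fin n))
    (z : X × Y × Y) : ℝ :=
  μ z.1 * softmaxPolicy ψ θ z.1 z.2.1 * softmaxPolicy ψ θ z.1 z.2.2

/-- The pairwise logit
`h_θ(x,y₁,y₂) = log(π_θ(y₁|x)/π_ref(y₁|x)) − log(π_θ(y₂|x)/π_ref(y₂|x))`. -/
noncomputable def pairLogit {n : ℕ} {X Y : Type*} [Fintype Y]
    (ψ : X × Y → EuclideanSpace ℝ (Fin n)) (θref θ : EuclideanSpace ℝ (Fin n))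
    (z : X × Y × Y) : ℝ :=
  Real.log (softmaxPolicy ψ θ z.1 z.2.1 / softmaxPolicy ψ θref z.1 z.2.1)
    - Real.log (softmaxPolicy ψ θ z.1 z.2.2 / softmaxPolicy ψ θref z.1 z.2.2)

/-- Per-sample loss for label 1: `ℓ¹_θ(z) = −log σ(β h_θ(z))`. -/
noncomputable def loss1 {n : ℕ} {X Y : Type*} [Fintype Y]
    (ψ : X × Y → EuclideanSpace ℝ (Fin n)) (θref : EuclideanSpace ℝ (Fin n)) (β : ℝ)
    (θ : EuclideanSpace ℝ (Fin n)) (z : X × Y × Y) : ℝ :=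
  - Real.log (sigmoid (β * pairLogit ψ θref θ z))

/-- Per-sample loss for label 0: `ℓ⁰_θ(z) = −log σ(−β h_θ(z))`. -/
noncomputable def loss0 {n : ℕ} {X Y : Type*} [Fintype Y]
    (ψ : X × Y → EuclideanSpace ℝ (Fin n)) (θref : EuclideanSpace ℝ (Fin n)) (β : ℝ)
    (θ : EuclideanSpace ℝ (Fin n)) (z : X × Y × Y) : ℝ :=
  - Real.log (sigmoid (-(β * pairLogit ψ θref θ z)))

/-- The nominal SAIL objective. -/
noncomputable def LSAIL {n : ℕ} {X Y : Type*} [Fintype X] [Fintype Y] (μ : X → ℝ)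
    (ψ : X × Y → EuclideanSpace ℝ (Fin n)) (θref : EuclideanSpace ℝ (Fin n)) (β : ℝ)
    (pstar : X × Y × Y → ℝ) (θ : EuclideanSpace ℝ (Fin n)) : ℝ :=
  ∑ z : X × Y × Y, sampleWeight μ ψ θ z *
    (pstar z * loss1 ψ θref β θ z + (1 - pstar z) * loss0 ψ θref β θ z)

/-- The oracle-robust objective `L^W_ρ(θ)`: worst case over pointwise perturbations of radius ρ. -/
noncomputable def LRobust {n : ℕ} {X Y : Type*} [Fintype X] [Fintype Y] (μ : X → ℝ)
    (ψ : X × Y → EuclideanSpace ℝ (Fin n)) (θref : EuclideanSpace ℝ (Fin n)) (β : ℝ)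
    (pstar : X × Y × Y → ℝ) (ρ : ℝ) (θ : EuclideanSpace ℝ (Fin n)) : ℝ :=
  sSup {v : ℝ | ∃ p : X × Y × Y → ℝ, (∀ z, p z ∈ Set.Icc (0 : ℝ) 1) ∧
    (∀ z, |p z - pstar z| ≤ ρ) ∧
    v = ∑ z : X × Y × Y, sampleWeight μ ψ θ z *
      (p z * loss1 ψ θref β θ z + (1 - p z) * loss0 ψ θref β θ z)}

/-- The robust penalty `R(θ) = E_{z∼d_θ} |⟪θ−θ_ref, ψ(x,y₁)−ψ(x,y₂)⟫|`. -/
noncomputable def Rpen {n : ℕ} {X Y : Type*} [Fintype X] [Fintype Y] (μ : X → ℝ)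
    (ψ : X × Y → EuclideanSpace ℝ (Fin n)) (θref θ : EuclideanSpace ℝ (Fin n)) : ℝ :=
  ∑ z : X × Y × Y, sampleWeight μ ψ θ z *
    |⟪θ - θref, ψ (z.1, z.2.1) - ψ (z.1, z.2.2)⟫|

theorem log_sigmoid_sub_log_sigmoid_neg (u : ℝ) :
    Real.log (sigmoid u) - Real.log (sigmoid (-u)) = u := by
  have h : 1 + Real.exp u = Real.exp u * (1 + Real.exp (-u)) := by
    rw [mul_add, ← Real.exp_add]
    simp [add_comm]
  have h0 : 1 + Real.exp (-u) ≠ 0 := by positivity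
  simp only [sigmoid, neg_neg, one_div, Real.log_inv]
  rw [h, Real.log_mul (Real.exp_ne_zero u) h0, Real.log_exp]
  ring

section Softmax

variable {n : ℕ} {X Y : Type*} [Fintype Y] (ψ : X × Y → EuclideanSpace ℝ (Fin n))

theorem softmaxPolicy_nonneg (θ : EuclideanSpace ℝ (Fin n)) (x : X) (y : Y) :
    0 ≤ softmaxPolicy ψ θ x y := by
  unfold softmaxPolicy
  positivity

theorem sampleWeight_nonneg {μ : X → ℝ} (hμ : ∀ x, 0 ≤ μ x) (θ : EuclideanSpace ℝ (Fin n))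
    (z : X × Y × Y) : 0 ≤ sampleWeight μ ψ θ z :=
  mul_nonneg (mul_nonneg (hμ _) (softmaxPolicy_nonneg ψ θ _ _)) (softmaxPolicy_nonneg ψ θ _ _)

theorem softmaxPolicy_pos (θ : EuclideanSpace ℝ (Fin n)) (x : X) (y : Y) :
    0 < softmaxPolicy ψ θ x y :=
  div_pos (Real.exp_pos _) (Finset.sum_pos (fun _ _ => Real.exp_pos _) ⟨y, Finset.mem_univ y⟩)

theorem log_softmaxPolicy (θ : EuclideanSpace ℝ (Fin n)) (x : X) (y : Y) :
    Real.log (softmaxPolicy ψ θ x y)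
      = ⟪θ, ψ (x, y)⟫ - Real.log (∑ y' : Y, Real.exp ⟪θ, ψ (x, y')⟫) := by
  have hsum : 0 < ∑ y' : Y, Real.exp ⟪θ, ψ (x, y')⟫ :=
    Finset.sum_pos (fun _ _ => Real.exp_pos _) ⟨y, Finset.mem_univ y⟩
  rw [softmaxPolicy, Real.log_div (Real.exp_ne_zero _) hsum.ne', Real.log_exp]

theorem pairLogit_eq_inner (θref θ : EuclideanSpace ℝ (Fin n)) (z : X × Y × Y) :
    pairLogit ψ θref θ z = ⟪θ - θref, ψ (z.1, z.2.1) - ψ (z.1, z.2.2)⟫ := by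
  have hne (θ : EuclideanSpace ℝ (Fin n)) (y : Y) := (softmaxPolicy_pos ψ θ z.1 y).ne'
  rw [pairLogit, Real.log_div (hne _ _) (hne _ _), Real.log_div (hne _ _) (hne _ _)]
  simp only [log_softmaxPolicy, inner_sub_left, inner_sub_right]
  ring

theorem expected_loss_eq (θref θ : EuclideanSpace ℝ (Fin n)) (β p q : ℝ) (z : X × Y × Y) :
    p * loss1 ψ θref β θ z + (1 - p) * loss0 ψ θref β θ z
      = q * loss1 ψ θref β θ z + (1 - q) * loss0 ψ θref β θ z
        + β * ((q - p) * ⟪θ - θref, ψ (z.1, z.2.1) - ψ (z.1, z.2.2)⟫) := by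
  have h := log_sigmoid_sub_log_sigmoid_neg (β * pairLogit ψ θref θ z)
  rw [← pairLogit_eq_inner]
  unfold loss1 loss0
  linear_combination (q - p) * h

end Softmax

/-- Theorem 4.1, decomposition of the oracle-robust SAIL objective:
`L^W_ρ(θ) = L_SAIL(θ) + ρβ·R(θ)`. -/
theorem stmt3 {n : ℕ} {X Y : Type*} [Fintype X] [Fintype Y] [Nonempty X] [Nonempty Y]
    (μ : X → ℝ) (hμ : ∀ x, μ x ∈ Set.Icc (0 : ℝ) 1) (hμsum : ∑ x, μ x = 1)
    (ψ : X × Y → EuclideanSpace ℝ (Fin n)) (θref : EuclideanSpace ℝ (Fin n))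
    (β : ℝ) (hβ : 0 < β) (δ : ℝ) (hδ : δ ∈ Set.Ioc (0 : ℝ) (1 / 2))
    (ρ : ℝ) (hρ : ρ ∈ Set.Ioo 0 δ)
    (pstar : X × Y × Y → ℝ) (hps : ∀ z, pstar z ∈ Set.Icc δ (1 - δ)) :
    ∀ θ : EuclideanSpace ℝ (Fin n),
      LRobust μ ψ θref β pstar ρ θ
        = LSAIL μ ψ θref β pstar θ + ρ * β * Rpen μ ψ θref θ := by
  intro θ
  let g (z : X × Y × Y) : ℝ := ⟪θ - θref, ψ (z.1, z.2.1) - ψ (z.1, z.2.2)⟫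
  have hsplit : LSAIL μ ψ θref β pstar θ + ρ * β * Rpen μ ψ θref θ
      = ∑ z : X × Y × Y, sampleWeight μ ψ θ z *
        (pstar z * loss1 ψ θref β θ z + (1 - pstar z) * loss0 ψ θref β θ z
          + β * (ρ * |g z|)) := by
    rw [LSAIL, Rpen, Finset.mul_sum, ← Finset.sum_add_distrib]
    exact Finset.sum_congr rfl fun z _ => by ring
  rw [hsplit]
  refine IsGreatest.csSup_eq ⟨⟨fun z => pstar z - ρ * SignType.sign (g z), ?_, ?_, ?_⟩, ?_⟩
  · intro z
    obtain ⟨h1, h2⟩ := hps z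
    obtain ⟨h3, h4⟩ := hρ
    rcases lt_trichotomy (g z) 0 with h | h | h <;> constructor <;> simp [h] <;> linarith
  · intro z
    have h3 := hρ.1
    rcases lt_trichotomy (g z) 0 with h | h | h <;> simp [h, abs_of_pos h3, h3.le]
  · refine Finset.sum_congr rfl fun z _ => ?_
    rw [expected_loss_eq ψ θref θ β (pstar z - ρ * SignType.sign (g z)) (pstar z),
      ← sign_mul_self (g z)]
    ring
  · rintro v ⟨p, -, hp, rfl⟩
    refine Finset.sum_le_sum fun z _ => ?_
    refine mul_le_mul_of_nonneg_left ?_ (sampleWeight_nonneg ψ (fun x => (hμ x).1) θ z)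
    rw [expected_loss_eq ψ θref θ β (p z) (pstar z)]
    refine add_le_add_right (mul_le_mul_of_nonneg_left ?_ hβ.le) _
    calc (pstar z - p z) * g z ≤ |(pstar z - p z) * g z| := le_abs_self _
      _ = |p z - pstar z| * |g z| := by rw [abs_mul, abs_sub_comm]
      _ ≤ ρ * |g z| := by gcongr; exact hp z
end

section
/- Define R : ℝ → ℝ by R(θ) := 2|θ|·σ(θ)·σ(−θ) = 2|θ|·e^θ/(1+e^θ)², where σ(u) = 1/(1+e^{−u}). Then R(1) − (1/2)·R(2) = 2e(e−1)(e³−1)/((1+e)²(1+e²)²) > 0; in particular R(1) > (R(0)+R(2))/2, so R is not convex. -/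
/-- The robust penalty of the one-dimensional counterexample:
`R(θ) = 2|θ|·σ(θ)·σ(−θ)`. -/
noncomputable def Rc (θ : ℝ) : ℝ := 2 * |θ| * sigmoid θ * sigmoid (-θ)

theorem Rc_eq (θ : ℝ) : Rc θ = 2 * |θ| * Real.exp θ / (1 + Real.exp θ) ^ 2 := by
  have h := Real.exp_pos θ
  rw [Rc, sigmoid, sigmoid, neg_neg, Real.exp_neg]
  field_simp
  ring

theorem Rc_one_sub_half_Rc_two :
    Rc 1 - (1 / 2) * Rc 2
      = 2 * Real.exp 1 * (Real.exp 1 - 1) * ((Real.exp 1) ^ 3 - 1)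
          / ((1 + Real.exp 1) ^ 2 * (1 + (Real.exp 1) ^ 2) ^ 2) := by
  have h := Real.exp_pos 1
  have h2 : Real.exp 2 = Real.exp 1 ^ 2 := by
    rw [← Real.exp_nat_mul]
    norm_num
  rw [Rc_eq, Rc_eq, h2, abs_one, abs_two]
  field_simp
  ring

/-- counterexample of Section 4.3: `R(θ) = 2|θ|e^θ/(1+e^θ)²`,
`R(1) − R(2)/2 = 2e(e−1)(e³−1)/((1+e)²(1+e²)²) > 0`, hence `R(1) > (R(0)+R(2))/2`
and `R` is not convex. -/
theorem stmt4 :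
    (∀ θ : ℝ, Rc θ = 2 * |θ| * Real.exp θ / (1 + Real.exp θ) ^ 2) ∧
    Rc 1 - (1 / 2) * Rc 2
      = 2 * Real.exp 1 * (Real.exp 1 - 1) * ((Real.exp 1) ^ 3 - 1)
          / ((1 + Real.exp 1) ^ 2 * (1 + (Real.exp 1) ^ 2) ^ 2) ∧
    0 < 2 * Real.exp 1 * (Real.exp 1 - 1) * ((Real.exp 1) ^ 3 - 1)
          / ((1 + Real.exp 1) ^ 2 * (1 + (Real.exp 1) ^ 2) ^ 2) ∧
    (Rc 0 + Rc 2) / 2 < Rc 1 ∧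
    ¬ ConvexOn ℝ Set.univ Rc := by
  have hpos : 0 < 2 * Real.exp 1 * (Real.exp 1 - 1) * ((Real.exp 1) ^ 3 - 1)
      / ((1 + Real.exp 1) ^ 2 * (1 + (Real.exp 1) ^ 2) ^ 2) := by
    have h : 1 < Real.exp 1 := Real.one_lt_exp_iff.2 one_pos
    have h1 : 0 < Real.exp 1 - 1 := sub_pos.2 h
    have h3 : 0 < Real.exp 1 ^ 3 - 1 := sub_pos.2 (one_lt_pow₀ h (by norm_num))
    positivity
  have hmid : (Rc 0 + Rc 2) / 2 < Rc 1 := by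
    have h0 : Rc 0 = 0 := by simp [Rc]
    linarith [Rc_one_sub_half_Rc_two]
  refine ⟨Rc_eq, Rc_one_sub_half_Rc_two, hpos, hmid, fun hc => ?_⟩
  have h := hc.2 (Set.mem_univ 0) (Set.mem_univ 2) (by norm_num : (0 : ℝ) ≤ 1 / 2)
    (by norm_num : (0 : ℝ) ≤ 1 / 2) (by norm_num)
  norm_num [smul_eq_mul] at h
  linarith
end

section
/- Let Θ ⊆ ℝ^d be nonempty closed convex, F : ℝ^d → (−∞,∞] with F = f + I_Θ for f : ℝ^d → ℝ, and assume F is κ-weakly convex (κ > 0) and bounded below. Fix λ ∈ (0, 1/κ), set L_env := 1/(λ(1 − κλ)), and fix θ ∈ Θ and a stepsize η > 0. Let G be a random vector in ℝ^d on a probability space with E[‖G‖²] < ∞ and E[G] ∈ ∂F(θ). Then E[F_λ(proj_Θ(θ − η·G))] ≤ F_λ(θ) − η(1 − κλ)·‖∇F_λ(θ)‖² + (L_env·η²/2)·E[‖G‖²]. -/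
open scoped RealInnerProductSpace
open MeasureTheory

/-- Subdifferential of the `κ`-weakly convex function `F = f + I_Θ`:
since `F y = +∞` off `Θ`, the defining inequality is only required for `y ∈ Θ`. -/
def wsubdiffOn {n : ℕ} (Θ : Set (EuclideanSpace ℝ (Fin n))) (κ : ℝ)
    (f : EuclideanSpace ℝ (Fin n) → ℝ) (x : EuclideanSpace ℝ (Fin n)) :
    Set (EuclideanSpace ℝ (Fin n)) :=
  {g | ∀ y ∈ Θ, f x + ⟪g, y - x⟫ - (κ / 2) * ‖y - x‖ ^ 2 ≤ f y}

/-- Moreau envelope of `F = f + I_Θ`: `F_λ(z) = inf_{u ∈ Θ} { f(u) + (1/(2λ))‖u−z‖² }`. -/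
noncomputable def envOn {n : ℕ} (Θ : Set (EuclideanSpace ℝ (Fin n)))
    (f : EuclideanSpace ℝ (Fin n) → ℝ) (lam : ℝ) (z : EuclideanSpace ℝ (Fin n)) : ℝ :=
  ⨅ u : Θ, (f u + (1 / (2 * lam)) * ‖(u : EuclideanSpace ℝ (Fin n)) - z‖ ^ 2)

lemma metricProjection_eq_self {E : Type*} [NormedAddCommGroup E] {K : Set E} {p : E → E}
    (hp : ∀ z, p z ∈ K ∧ ∀ u ∈ K, ‖p z - z‖ ≤ ‖u - z‖) {u : E} (hu : u ∈ K) : p u = u := by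
  have h := (hp u).2 u hu
  rw [sub_self, norm_zero] at h
  exact sub_eq_zero.1 (norm_le_zero_iff.1 h)

section MetricProjection

variable {E : Type*} [NormedAddCommGroup E] [InnerProductSpace ℝ E] {K : Set E} {p : E → E}

lemma lipschitzWith_one_of_metricProjection (hK : Convex ℝ K)
    (hp : ∀ z, p z ∈ K ∧ ∀ u ∈ K, ‖p z - z‖ ≤ ‖u - z‖) : LipschitzWith 1 p := by
  have variational : ∀ z, ∀ w ∈ K, ⟪z - p z, w - p z⟫ ≤ 0 := by
    intro z
    refine (norm_eq_iInf_iff_real_inner_le_zero hK (hp z).1).1 (le_antisymm ?_ ?_)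
    · have : Nonempty K := ⟨⟨p z, (hp z).1⟩⟩
      refine le_ciInf fun w => ?_
      rw [norm_sub_rev z, norm_sub_rev z]
      exact (hp z).2 w w.2
    · exact ciInf_le (f := fun w : K => ‖z - w‖)
        ⟨0, Set.forall_mem_range.2 fun _ => norm_nonneg _⟩ ⟨p z, (hp z).1⟩
  refine LipschitzWith.of_dist_le_mul fun x y => ?_
  rw [NNReal.coe_one, one_mul, dist_eq_norm, dist_eq_norm]
  have hx := variational x (p y) (hp y).1
  have hy := variational y (p x) (hp x).1
  have hxy : ‖p x - p y‖ ^ 2 = ⟪x - y, p x - p y⟫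
      + ⟪x - p x, p y - p x⟫ + ⟪y - p y, p x - p y⟫ := by
    rw [← neg_sub (p x) (p y), inner_neg_right, ← real_inner_self_eq_norm_sq]
    simp only [inner_sub_left]
    ring
  have hcs := real_inner_le_norm (x - y) (p x - p y)
  by_contra! hlt
  nlinarith [norm_nonneg (x - y), norm_nonneg (p x - p y)]

/-- Quadratic growth of the proximal objective of a weakly convex function at its minimizer. -/
lemma add_norm_sq_le_of_isMinOn_prox {f : E → ℝ} {κ c : ℝ} {x v : E}
    (hf : ConvexOn ℝ K (fun u => f u + (κ / 2) * ‖u‖ ^ 2)) (hx : x ∈ K) (hv : v ∈ K)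
    (hmin : IsMinOn (fun u => f u + c * ‖u - x‖ ^ 2) K v) :
    f v + (2 * c - κ / 2) * ‖v - x‖ ^ 2 ≤ f x := by
  have key : ∀ t ∈ Set.Ioo (0 : ℝ) 1, f v + (2 * c - κ / 2) * ‖v - x‖ ^ 2
      ≤ f x + t * ((c - κ / 2) * ‖v - x‖ ^ 2) := by
    rintro t ⟨ht0, ht1⟩
    have hmem := hf.1 hv hx (sub_nonneg.2 ht1.le) ht0.le (sub_add_cancel 1 t)
    have hcx := hf.2 hv hx (sub_nonneg.2 ht1.le) ht0.le (sub_add_cancel 1 t)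
    have hm : f v + c * ‖v - x‖ ^ 2 ≤ _ := hmin hmem
    have hd : (1 - t) • v + t • x - x = (1 - t) • (v - x) := by module
    have hn : ‖(1 - t) • v + t • x‖ ^ 2
        = (1 - t) * ‖v‖ ^ 2 + t * ‖x‖ ^ 2 - t * (1 - t) * ‖v - x‖ ^ 2 := by
      rw [norm_add_sq_real, norm_sub_sq_real, norm_smul, norm_smul, mul_pow, mul_pow,
        Real.norm_eq_abs, Real.norm_eq_abs, sq_abs, sq_abs, real_inner_smul_left,
        real_inner_smul_right]
      ring
    simp only [hd, norm_smul, mul_pow, Real.norm_eq_abs, sq_abs] at hm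
    simp only [hn, smul_eq_mul] at hcx
    refine le_of_mul_le_mul_left ?_ ht0
    linarith
  have hlim : Filter.Tendsto (fun t : ℝ => f x + t * ((c - κ / 2) * ‖v - x‖ ^ 2))
      (nhdsWithin 0 (Set.Ioi 0)) (nhds (f x)) := by
    have : Continuous fun t : ℝ => f x + t * ((c - κ / 2) * ‖v - x‖ ^ 2) := by fun_prop
    simpa using (this.tendsto 0).mono_left nhdsWithin_le_nhds
  exact ge_of_tendsto hlim
    (Filter.mem_of_superset (Ioo_mem_nhdsGT one_pos) key)

end MetricProjection

section MoreauEnvelope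

variable {n : ℕ} {Θ : Set (EuclideanSpace ℝ (Fin n))} {f : EuclideanSpace ℝ (Fin n) → ℝ}
  {lam m : ℝ}

lemma le_add_mul_norm_sq (hm : ∀ u ∈ Θ, m ≤ f u) (hlam : 0 ≤ lam)
    (z : EuclideanSpace ℝ (Fin n)) (u : Θ) :
    m ≤ f u + (1 / (2 * lam)) * ‖(u : EuclideanSpace ℝ (Fin n)) - z‖ ^ 2 :=
  (hm u u.2).trans (le_add_of_nonneg_right (by positivity))

lemma bddBelow_range_envOn (hm : ∀ u ∈ Θ, m ≤ f u) (hlam : 0 ≤ lam)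
    (z : EuclideanSpace ℝ (Fin n)) :
    BddBelow (Set.range fun u : Θ =>
      f u + (1 / (2 * lam)) * ‖(u : EuclideanSpace ℝ (Fin n)) - z‖ ^ 2) :=
  ⟨m, Set.forall_mem_range.2 (le_add_mul_norm_sq hm hlam z)⟩

lemma le_envOn (hne : Θ.Nonempty) (hm : ∀ u ∈ Θ, m ≤ f u) (hlam : 0 ≤ lam)
    (z : EuclideanSpace ℝ (Fin n)) : m ≤ envOn Θ f lam z :=
  have := hne.to_subtype
  le_ciInf (le_add_mul_norm_sq hm hlam z)

lemma envOn_le (hm : ∀ u ∈ Θ, m ≤ f u) (hlam : 0 ≤ lam)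
    (z : EuclideanSpace ℝ (Fin n)) {u : EuclideanSpace ℝ (Fin n)} (hu : u ∈ Θ) :
    envOn Θ f lam z ≤ f u + (1 / (2 * lam)) * ‖u - z‖ ^ 2 :=
  ciInf_le (bddBelow_range_envOn hm hlam z) ⟨u, hu⟩

lemma measurable_envOn (hm : ∀ u ∈ Θ, m ≤ f u) (hlam : 0 ≤ lam) :
    Measurable (envOn Θ f lam) :=
  (upperSemicontinuous_ciInf (bddBelow_range_envOn hm hlam)
    fun u => Continuous.upperSemicontinuous (by fun_prop)).measurable

end MoreauEnvelope

/-- Lemma C.2, one-step descent inequality: for `F = f + I_Θ` `κ`-weakly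
convex and bounded below, `λ ∈ (0,1/κ)`, `L_env = 1/(λ(1−κλ))`, `θ ∈ Θ`, stepsize `η > 0`,
and a random vector `G` with `E‖G‖² < ∞` and `E[G] ∈ ∂F(θ)`:
`E[F_λ(proj_Θ(θ − ηG))] ≤ F_λ(θ) − η(1−κλ)‖∇F_λ(θ)‖² + (L_env η²/2)·E‖G‖²`,
where `∇F_λ(θ) = (θ − θ̂)/λ` with `θ̂` the proximal point. -/
theorem stmt14 {n : ℕ} (Θ : Set (EuclideanSpace ℝ (Fin n))) (hne : Θ.Nonempty)
    (hcl : IsClosed Θ) (hconv : Convex ℝ Θ)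
    (f : EuclideanSpace ℝ (Fin n) → ℝ) (κ : ℝ) (hκ : 0 < κ)
    (hwc : ConvexOn ℝ Θ (fun θ => f θ + (κ / 2) * ‖θ‖ ^ 2))
    (Finf : ℝ) (hFinf : ∀ u ∈ Θ, Finf ≤ f u)
    (lam : ℝ) (hlam : lam ∈ Set.Ioo 0 (1 / κ))
    (η : ℝ) (hη : 0 < η)
    (θ : EuclideanSpace ℝ (Fin n)) (hθ : θ ∈ Θ)
    (proj : EuclideanSpace ℝ (Fin n) → EuclideanSpace ℝ (Fin n))
    (hproj : ∀ z, proj z ∈ Θ ∧ ∀ u ∈ Θ, ‖proj z - z‖ ≤ ‖u - z‖)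
    (θhat : EuclideanSpace ℝ (Fin n)) (hθhatmem : θhat ∈ Θ)
    (hθhat : IsMinOn (fun u => f u + (1 / (2 * lam)) * ‖u - θ‖ ^ 2) Θ θhat)
    {Ω : Type*} [MeasurableSpace Ω] (P : Measure Ω) [IsProbabilityMeasure P]
    (G : Ω → EuclideanSpace ℝ (Fin n))
    (hGint : Integrable G P) (hG2 : Integrable (fun ω => ‖G ω‖ ^ 2) P)
    (hmean : (∫ ω, G ω ∂P) ∈ wsubdiffOn Θ κ f θ) :
    ∫ ω, envOn Θ f lam (proj (θ - η • G ω)) ∂P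
      ≤ envOn Θ f lam θ - η * (1 - κ * lam) * ‖(1 / lam) • (θ - θhat)‖ ^ 2
        + (1 / (lam * (1 - κ * lam))) * η ^ 2 / 2 * ∫ ω, ‖G ω‖ ^ 2 ∂P := by
  obtain ⟨hlam0, hlam1⟩ := hlam
  have hκlam : 0 < 1 - κ * lam := by
    rw [lt_div_iff₀ hκ] at hlam1
    linarith
  have hgrowth := add_norm_sq_le_of_isMinOn_prox hwc hθ hθhatmem hθhat
  have hsub := hmean θhat hθhatmem
  have henv : f θhat + (1 / (2 * lam)) * ‖θhat - θ‖ ^ 2 ≤ envOn Θ f lam θ :=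
    have := hne.to_subtype
    le_ciInf fun u => hθhat u.2
  have hlip := lipschitzWith_one_of_metricProjection hconv hproj
  have hpoint : ∀ ω, envOn Θ f lam (proj (θ - η • G ω)) ≤
      (f θhat + (1 / (2 * lam)) * ‖θhat - θ‖ ^ 2) + (η / lam) * ⟪θhat - θ, G ω⟫
        + η ^ 2 / (2 * lam) * ‖G ω‖ ^ 2 := by
    intro ω
    have hdist : ‖θhat - proj (θ - η • G ω)‖ ≤ ‖(θhat - θ) + η • G ω‖ := by
      have h := hlip.dist_le_mul θhat (θ - η • G ω)
      rwa [metricProjection_eq_self hproj hθhatmem, NNReal.coe_one, one_mul, dist_eq_norm,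
        dist_eq_norm, ← sub_add] at h
    calc envOn Θ f lam (proj (θ - η • G ω))
        ≤ f θhat + (1 / (2 * lam)) * ‖θhat - proj (θ - η • G ω)‖ ^ 2 :=
          envOn_le hFinf hlam0.le _ hθhatmem
      _ ≤ f θhat + (1 / (2 * lam)) * ‖(θhat - θ) + η • G ω‖ ^ 2 := by gcongr
      _ = _ := by
          rw [norm_add_sq_real, real_inner_smul_right, norm_smul, mul_pow, Real.norm_eq_abs,
            sq_abs]
          field_simp
          ring
  have hinner : Integrable (fun ω => ⟪θhat - θ, G ω⟫) P := hGint.const_inner _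
  have hint₁ : Integrable (fun ω => (f θhat + (1 / (2 * lam)) * ‖θhat - θ‖ ^ 2)
      + (η / lam) * ⟪θhat - θ, G ω⟫) P := (integrable_const _).add (hinner.const_mul _)
  have hint₂ : Integrable (fun ω => η ^ 2 / (2 * lam) * ‖G ω‖ ^ 2) P := hG2.const_mul _
  have hint : Integrable (fun ω => envOn Θ f lam (proj (θ - η • G ω))) P := by
    refine integrable_of_le_of_le ?_ (.of_forall fun ω => le_envOn hne hFinf hlam0.le _)
      (.of_forall hpoint) (integrable_const _) (hint₁.add hint₂)
    have hG : AEMeasurable (fun ω => θ - η • G ω) P :=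
      (hGint.aemeasurable.const_smul η).const_sub θ
    exact (((measurable_envOn hFinf hlam0.le).comp
      hlip.continuous.measurable).comp_aemeasurable hG).aestronglyMeasurable
  have hmono := integral_mono hint (hint₁.add hint₂) hpoint
  simp only [Pi.add_apply] at hmono
  rw [integral_add hint₁ hint₂, integral_add (integrable_const _) (hinner.const_mul _),
    integral_const_mul, integral_const_mul, integral_inner hGint, integral_const,
    probReal_univ, one_smul] at hmono
  have hstep : ⟪θhat - θ, ∫ ω, G ω ∂P⟫ ≤ -((1 - κ * lam) / lam * ‖θhat - θ‖ ^ 2) := by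
    rw [real_inner_comm]
    have : 2 * (1 / (2 * lam)) - κ / 2 = (1 - κ * lam) / lam + κ / 2 := by
      field_simp
      ring
    rw [this] at hgrowth
    linarith
  have hdescent := mul_le_mul_of_nonneg_left hstep (div_pos hη hlam0).le
  have hgrad : ‖(1 / lam) • (θ - θhat)‖ ^ 2 = ‖θhat - θ‖ ^ 2 / lam ^ 2 := by
    rw [norm_smul, mul_pow, Real.norm_eq_abs, sq_abs, norm_sub_rev]
    ring
  have hcoef : η ^ 2 / (2 * lam) ≤ (1 / (lam * (1 - κ * lam))) * η ^ 2 / 2 := by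
    have : 1 / lam ≤ 1 / (lam * (1 - κ * lam)) :=
      one_div_le_one_div_of_le (by positivity) (by nlinarith [mul_pos hκ hlam0])
    calc η ^ 2 / (2 * lam) = 1 / lam * η ^ 2 / 2 := by ring
      _ ≤ _ := by gcongr
  have hvar := mul_le_mul_of_nonneg_right hcoef
    (integral_nonneg (μ := P) fun ω => sq_nonneg ‖G ω‖)
  rw [hgrad]
  have hrew : η / lam * -((1 - κ * lam) / lam * ‖θhat - θ‖ ^ 2)
      = -(η * (1 - κ * lam) * (‖θhat - θ‖ ^ 2 / lam ^ 2)) := by ring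
  rw [hrew] at hdescent
  linarith
end

section
/- Let F : ℝ → ℝ be F(θ) = |θ| (which is convex, hence 0-weakly convex) and take the Moreau-envelope parameter λ = 1. Then for every θ ∈ (0,1): (i) the unique minimizer of u ↦ |u| + (1/2)(u − θ)² is u = 0, so prox_{1·F}(θ) = 0 and ∇F_1(θ) = θ; (ii) the convex subdifferential of F at θ is {1}, so dist(0, ∂F(θ)) = 1. Consequently dist(0, ∂F(θ))/‖∇F_1(θ)‖ = 1/θ → ∞ as θ ↓ 0, so there is no finite constant C with dist(0, ∂F(θ)) ≤ C·‖∇F_1(θ)‖ for all θ ∈ (0,1). -/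
/-- The Moreau objective of `|·|` with parameter `1` grows at least quadratically away from `0`. -/
theorem abs_moreau_quadratic_growth {θ : ℝ} (hθ : |θ| ≤ 1) (u : ℝ) :
    (1 / 2) * θ ^ 2 + (1 / 2) * u ^ 2 ≤ |u| + (1 / 2) * (u - θ) ^ 2 := by
  have h : u * θ ≤ |u| :=
    calc u * θ ≤ |u * θ| := le_abs_self _
      _ = |u| * |θ| := abs_mul u θ
      _ ≤ |u| := mul_le_of_le_one_right (abs_nonneg u) hθ
  linarith [show (u - θ) ^ 2 = u ^ 2 - 2 * (u * θ) + θ ^ 2 by ring]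

theorem abs_subdifferential_of_pos {θ : ℝ} (hθ : 0 < θ) :
    {g : ℝ | ∀ y : ℝ, |θ| + g * (y - θ) ≤ |y|} = {1} := by
  ext g
  simp only [Set.mem_ofPred_eq, Set.mem_singleton_iff, abs_of_pos hθ]
  constructor
  · intro h
    have h0 := h 0
    have h2 := h (2 * θ)
    rw [abs_zero] at h0
    rw [abs_of_pos (by positivity)] at h2
    apply le_antisymm <;> nlinarith
  · rintro rfl y
    linarith [le_abs_self y]

theorem infDist_abs_subdifferential_of_pos {θ : ℝ} (hθ : 0 < θ) :
    Metric.infDist (0 : ℝ) {g : ℝ | ∀ y : ℝ, |θ| + g * (y - θ) ≤ |y|} = 1 := by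
  rw [abs_subdifferential_of_pos hθ, Metric.infDist_singleton]
  simp

/-- counterexample in Lemma D.1: for `F(θ) = |θ|` and envelope parameter
`λ = 1`, for every `θ ∈ (0,1)` the unique minimizer of `u ↦ |u| + (1/2)(u−θ)²` is `0`
(so `prox_{1·F}(θ) = 0` and `∇F₁(θ) = θ`), the convex subdifferential of `F` at `θ` is `{1}`
(so `dist(0, ∂F(θ)) = 1`); moreover `1/θ → ∞` as `θ ↓ 0`, so there is no finite constant `C`
with `dist(0, ∂F(θ)) ≤ C‖∇F₁(θ)‖` on `(0,1)`. -/
theorem stmt17 :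
    (∀ θ ∈ Set.Ioo (0 : ℝ) 1,
      (IsMinOn (fun u : ℝ => |u| + (1 / 2) * (u - θ) ^ 2) Set.univ 0 ∧
        ∀ u : ℝ, IsMinOn (fun u' : ℝ => |u'| + (1 / 2) * (u' - θ) ^ 2) Set.univ u → u = 0) ∧
      {g : ℝ | ∀ y : ℝ, |θ| + g * (y - θ) ≤ |y|} = {1} ∧
      Metric.infDist (0 : ℝ) {g : ℝ | ∀ y : ℝ, |θ| + g * (y - θ) ≤ |y|} = 1) ∧
    Filter.Tendsto (fun θ : ℝ => 1 / θ) (nhdsWithin 0 (Set.Ioi 0)) Filter.atTop ∧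
    ¬ ∃ C : ℝ, ∀ θ ∈ Set.Ioo (0 : ℝ) 1,
      Metric.infDist (0 : ℝ) {g : ℝ | ∀ y : ℝ, |θ| + g * (y - θ) ≤ |y|} ≤ C * ‖θ‖ := by
  refine ⟨fun θ hθ => ?_, ?_, ?_⟩
  · have growth := abs_moreau_quadratic_growth (abs_le.2 ⟨by linarith [hθ.1], hθ.2.le⟩)
    refine ⟨⟨fun u _ => ?_, fun u hu => ?_⟩, abs_subdifferential_of_pos hθ.1,
      infDist_abs_subdifferential_of_pos hθ.1⟩
    · simp only [Set.mem_ofPred_eq, abs_zero]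
      linarith [growth u, sq_nonneg u, show (0 - θ) ^ 2 = θ ^ 2 by ring]
    · have h := isMinOn_iff.1 hu 0 (Set.mem_univ 0)
      simp only [abs_zero] at h
      have hsq : u ^ 2 ≤ 0 := by linarith [growth u, show (0 - θ) ^ 2 = θ ^ 2 by ring]
      exact pow_eq_zero_iff two_ne_zero |>.1 (le_antisymm hsq (sq_nonneg u))
  · simpa only [one_div] using tendsto_inv_nhdsGT_zero
  · rintro ⟨C, hC⟩
    have hpos : 0 < |C| + 2 := by positivity
    have hθ : 0 < (|C| + 2)⁻¹ := inv_pos.2 hpos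
    have h := hC _ ⟨hθ, inv_lt_one_of_one_lt₀ (by linarith [abs_nonneg C])⟩
    rw [infDist_abs_subdifferential_of_pos hθ, Real.norm_of_nonneg hθ.le, ← div_eq_mul_inv,
      one_le_div hpos] at h
    linarith [le_abs_self C]
end
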